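/- Let -(1/2)√(1+2c) < ξ < -(1/2)√(1-2c). Then there is exactly one ω ∈ ℂ ∖ 𝒞 with Re ω ≥ 0 and Im ω ≥ 0 satisfying the saddle point equation with ξ₁ = ξ₂ = ξ; this solution has the form ω = e^{iθ_c} for some θ_c ∈ (0, π/2), and Re g_ξ(ω) = 0. -/

import Mathlib

/-- `c = a/(1+a²)`. -/
noncomputable def cOf (a : ℝ) : ℝ := a / (1 + a ^ 2)

/-- The branch of the logarithm with argument in `(-π/2, 3π/2]`:
`L(z) = Log(-iz) + iπ/2` where `Log` is the principal branch. -/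
noncomputable def Lbr (z : ℂ) : ℂ :=
  Complex.log (-Complex.I * z) + Complex.I * ((Real.pi : ℂ) / 2)

/-- The branch `√(ω² + 2c) = exp((1/2)L(ω + i√(2c)) + (1/2)L(ω - i√(2c)))`. -/
noncomputable def sqBr (a : ℝ) (ω : ℂ) : ℂ :=
  Complex.exp ((1 / 2 : ℂ) * Lbr (ω + Complex.I * (Real.sqrt (2 * cOf a) : ℂ)) +
    (1 / 2 : ℂ) * Lbr (ω - Complex.I * (Real.sqrt (2 * cOf a) : ℂ)))

/-- `G(ω) = (ω - √(ω² + 2c))/√(2c)`. -/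
noncomputable def Gbr (a : ℝ) (ω : ℂ) : ℂ :=
  (ω - sqBr a ω) / (Real.sqrt (2 * cOf a) : ℂ)

/-- The branch cuts `𝒞 = i·((-∞, -1/√(2c)] ∪ [-√(2c), √(2c)] ∪ [1/√(2c), ∞))`. -/
def cuts (a : ℝ) : Set ℂ :=
  {z : ℂ | ∃ t : ℝ, z = Complex.I * (t : ℂ) ∧
    (t ≤ -(1 / Real.sqrt (2 * cOf a)) ∨
      (-Real.sqrt (2 * cOf a) ≤ t ∧ t ≤ Real.sqrt (2 * cOf a)) ∨
      1 / Real.sqrt (2 * cOf a) ≤ t)}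

/-- The branch of the logarithm with argument in `(0, 2π]`: `L₃(z) = Log(-z) + iπ`. -/
noncomputable def L3 (z : ℂ) : ℂ := Complex.log (-z) + Complex.I * (Real.pi : ℂ)

/-- The saddle point function `g_ξ(ω) = L(ω) - ξ·L(G(ω)) + ξ·L₃(G(1/ω))`. -/
noncomputable def gxi (a ξ : ℝ) (ω : ℂ) : ℂ :=
  Lbr ω - (ξ : ℂ) * Lbr (Gbr a ω) + (ξ : ℂ) * L3 (Gbr a ω⁻¹)

/-- The saddle point equation `1 + ξ₁·ω/√(ω²+2c) + ξ₂/(ω·√(ω⁻²+2c)) = 0`. -/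
def saddleEq (a ξ₁ ξ₂ : ℝ) (ω : ℂ) : Prop :=
  1 + (ξ₁ : ℂ) * ω / sqBr a ω + (ξ₂ : ℂ) / (ω * sqBr a ω⁻¹) = 0

open Complex ComplexConjugate

lemma exp_Lbr {z : ℂ} (hz : z ≠ 0) : exp (Lbr z) = z := by
  have h : I * ((Real.pi : ℂ) / 2) = Real.pi / 2 * I := by ring
  rw [Lbr, exp_add, exp_log (mul_ne_zero (neg_ne_zero.2 I_ne_zero) hz), h, exp_pi_div_two_mul_I]
  linear_combination -z * I_mul_I

lemma Lbr_re (z : ℂ) : (Lbr z).re = Real.log ‖z‖ := by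
  simp [Lbr, log_re]

lemma L3_re (z : ℂ) : (L3 z).re = Real.log ‖z‖ := by
  simp [L3, log_re]

lemma Lbr_im (z : ℂ) : (Lbr z).im = arg (-I * z) + Real.pi / 2 := by
  have h : I * ((Real.pi : ℂ) / 2) = ((Real.pi / 2 : ℝ) : ℂ) * I := by push_cast; ring
  rw [Lbr, add_im, log_im, h, im_ofReal_mul, I_im, mul_one]

lemma abs_Lbr_im_lt {z : ℂ} (hz : 0 < z.re) : |(Lbr z).im| < Real.pi / 2 := by
  have h1 : arg (-I * z) < 0 := by
    rw [arg_neg_iff]; simpa using hz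
  have h2 := neg_pi_lt_arg (-I * z)
  rw [Lbr_im, abs_lt]
  constructor <;> linarith

lemma Lbr_im_I_mul_of_pos {t : ℝ} (ht : 0 < t) : (Lbr (I * t)).im = Real.pi / 2 := by
  have h : -I * (I * (t : ℂ)) = t := by linear_combination -(t : ℂ) * I_mul_I
  rw [Lbr_im, h, arg_ofReal_of_nonneg ht.le, zero_add]

lemma Lbr_im_I_mul_of_neg {t : ℝ} (ht : t < 0) : (Lbr (I * t)).im = 3 * (Real.pi / 2) := by
  have h : -I * (I * (t : ℂ)) = t := by linear_combination -(t : ℂ) * I_mul_I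
  rw [Lbr_im, h, arg_ofReal_of_neg ht]
  ring

lemma sqBr_ne_zero (a : ℝ) (z : ℂ) : sqBr a z ≠ 0 := exp_ne_zero _

/-- Away from the branch points, `sqBr` is a square root of `ω² + 2c`. -/
lemma sqBr_sq {a : ℝ} {z : ℂ} (h1 : z + I * (Real.sqrt (2 * cOf a) : ℂ) ≠ 0)
    (h2 : z - I * (Real.sqrt (2 * cOf a) : ℂ) ≠ 0) :
    sqBr a z ^ 2 = z ^ 2 + ((Real.sqrt (2 * cOf a) ^ 2 : ℝ) : ℂ) := by
  rw [sqBr, ← exp_nat_mul]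
  have h : ∀ u v : ℂ, ((2 : ℕ) : ℂ) * (1 / 2 * u + 1 / 2 * v) = u + v := by
    intro u v; push_cast; ring
  rw [h, exp_add, exp_Lbr h1, exp_Lbr h2]
  push_cast
  linear_combination -((Real.sqrt (2 * cOf a) : ℂ)) ^ 2 * I_mul_I

lemma sqBr_re_pos (a : ℝ) {z : ℂ} (hz : 0 < z.re) : 0 < (sqBr a z).re := by
  have h1 := abs_lt.1 (abs_Lbr_im_lt (z := z + I * (Real.sqrt (2 * cOf a) : ℂ)) (by simpa using hz))
  have h2 := abs_lt.1 (abs_Lbr_im_lt (z := z - I * (Real.sqrt (2 * cOf a) : ℂ)) (by simpa using hz))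
  rw [sqBr, exp_re]
  refine mul_pos (Real.exp_pos _) (Real.cos_pos_of_mem_Ioo ?_)
  simp only [add_im, mul_im, div_ofNat_re, div_ofNat_im, one_re, one_im]
  constructor <;> linarith

lemma sqBr_sq_of_re_pos (a : ℝ) {z : ℂ} (hz : 0 < z.re) :
    sqBr a z ^ 2 = z ^ 2 + ((Real.sqrt (2 * cOf a) ^ 2 : ℝ) : ℂ) := by
  apply sqBr_sq <;>
  · intro h
    have := congrArg re h
    simp at this
    linarith

lemma sqBr_I_mul_of_lt {a t : ℝ} (ht : Real.sqrt (2 * cOf a) < t) :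
    (sqBr a (I * t)).re = 0 ∧ 0 < (sqBr a (I * t)).im := by
  have h0 := Real.sqrt_nonneg (2 * cOf a)
  have e1 : I * (t : ℂ) + I * (Real.sqrt (2 * cOf a) : ℂ)
      = I * ((t + Real.sqrt (2 * cOf a) : ℝ) : ℂ) := by push_cast; ring
  have e2 : I * (t : ℂ) - I * (Real.sqrt (2 * cOf a) : ℂ)
      = I * ((t - Real.sqrt (2 * cOf a) : ℝ) : ℂ) := by push_cast; ring
  have h : ((1 / 2 : ℂ) * Lbr (I * ((t + Real.sqrt (2 * cOf a) : ℝ) : ℂ)) +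
      (1 / 2 : ℂ) * Lbr (I * ((t - Real.sqrt (2 * cOf a) : ℝ) : ℂ))).im = Real.pi / 2 := by
    simp only [add_im, mul_im, div_ofNat_re, div_ofNat_im, one_re, one_im]
    rw [Lbr_im_I_mul_of_pos (by linarith), Lbr_im_I_mul_of_pos (by linarith)]
    ring
  rw [sqBr, e1, e2, exp_re, exp_im, h, Real.cos_pi_div_two, Real.sin_pi_div_two]
  exact ⟨mul_zero _, by rw [mul_one]; exact Real.exp_pos _⟩

lemma sqBr_I_mul_of_lt_neg {a t : ℝ} (ht : t < -Real.sqrt (2 * cOf a)) :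
    (sqBr a (I * t)).re = 0 ∧ (sqBr a (I * t)).im < 0 := by
  have h0 := Real.sqrt_nonneg (2 * cOf a)
  have e1 : I * (t : ℂ) + I * (Real.sqrt (2 * cOf a) : ℂ)
      = I * ((t + Real.sqrt (2 * cOf a) : ℝ) : ℂ) := by push_cast; ring
  have e2 : I * (t : ℂ) - I * (Real.sqrt (2 * cOf a) : ℂ)
      = I * ((t - Real.sqrt (2 * cOf a) : ℝ) : ℂ) := by push_cast; ring
  have h : ((1 / 2 : ℂ) * Lbr (I * ((t + Real.sqrt (2 * cOf a) : ℝ) : ℂ)) +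
      (1 / 2 : ℂ) * Lbr (I * ((t - Real.sqrt (2 * cOf a) : ℝ) : ℂ))).im
      = Real.pi / 2 + Real.pi := by
    simp only [add_im, mul_im, div_ofNat_re, div_ofNat_im, one_re, one_im]
    rw [Lbr_im_I_mul_of_neg (by linarith), Lbr_im_I_mul_of_neg (by linarith)]
    ring
  rw [sqBr, e1, e2, exp_re, exp_im, h, Real.cos_add_pi, Real.sin_add_pi, Real.cos_pi_div_two,
    Real.sin_pi_div_two]
  exact ⟨by simp, by linarith [Real.exp_pos ((1 / 2 : ℂ) *
    Lbr (I * ((t + Real.sqrt (2 * cOf a) : ℝ) : ℂ)) +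
      (1 / 2 : ℂ) * Lbr (I * ((t - Real.sqrt (2 * cOf a) : ℝ) : ℂ))).re]⟩

lemma sqBr_conj (a : ℝ) {z : ℂ} (hz : 0 < z.re) : sqBr a (conj z) = conj (sqBr a z) := by
  have hz' : 0 < (conj z).re := by simpa using hz
  have h1 := sqBr_re_pos a hz
  have h2 := sqBr_re_pos a hz'
  have h : sqBr a (conj z) ^ 2 = (conj (sqBr a z)) ^ 2 := by
    rw [sqBr_sq_of_re_pos a hz', ← map_pow (starRingEnd ℂ) (sqBr a z), sqBr_sq_of_re_pos a hz,
      map_add, map_pow, conj_ofReal]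
  rcases sq_eq_sq_iff_eq_or_eq_neg.1 h with h | h
  · exact h
  · have := congrArg re h
    simp only [neg_re, conj_re] at this
    linarith

lemma div_re_pos {z w : ℂ} (h : 0 < z.re * w.re + z.im * w.im) : 0 < (z / w).re := by
  have hw : 0 < normSq w := by
    rw [normSq_pos]
    rintro rfl
    simp at h
  rw [div_re, ← add_div]
  exact div_pos h hw

lemma im_mul_im_nonneg_of_sq_eq {z w : ℂ} {q : ℝ} (hz : 0 < z.re) (hw : 0 < w.re)
    (h : w ^ 2 = z ^ 2 + (q : ℂ)) : 0 ≤ z.im * w.im ∧ (z.im = 0 → w.im = 0) := by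
  have h1 : w.re * w.im = z.re * z.im := by
    have := congrArg im h
    simp [pow_two] at this
    linarith
  refine ⟨?_, fun h0 => ?_⟩
  · have h2 : 0 ≤ w.re * (z.im * w.im) := by
      have : w.re * (z.im * w.im) = z.re * z.im ^ 2 := by linear_combination z.im * h1
      rw [this]; positivity
    exact nonneg_of_mul_nonneg_right h2 hw
  · rw [h0, mul_zero] at h1
    exact (mul_eq_zero.1 h1).resolve_left (ne_of_gt hw)

/-- Sign and square-root information about the two terms of the saddle point equation. -/
structure SaddleTerms (a : ℝ) (ω : ℂ) : Prop where
  ne_zero : ω ≠ 0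
  sq_left : sqBr a ω ^ 2 = ω ^ 2 + ((Real.sqrt (2 * cOf a) ^ 2 : ℝ) : ℂ)
  sq_right : sqBr a ω⁻¹ ^ 2 = ω⁻¹ ^ 2 + ((Real.sqrt (2 * cOf a) ^ 2 : ℝ) : ℂ)
  re_left : 0 < (ω / sqBr a ω).re
  re_right : 0 < (1 / (ω * sqBr a ω⁻¹)).re
  im_left : ω.re = 0 ∨ ω.im = 0 → (ω / sqBr a ω).im = 0

lemma saddleTerms_of_re_pos (a : ℝ) {ω : ℂ} (h : 0 < ω.re) : SaddleTerms a ω := by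
  have h0 : ω ≠ 0 := by rintro rfl; simp at h
  have hinv : 0 < (ω⁻¹).re := by
    rw [inv_re]; exact div_pos h (normSq_pos.2 h0)
  have hS := sqBr_re_pos a h
  have hT := sqBr_re_pos a hinv
  have hS2 := sqBr_sq_of_re_pos a h
  have hT2 := sqBr_sq_of_re_pos a hinv
  obtain ⟨i1, i2⟩ := im_mul_im_nonneg_of_sq_eq h hS hS2
  obtain ⟨j1, -⟩ := im_mul_im_nonneg_of_sq_eq hinv hT hT2
  refine ⟨h0, hS2, hT2, div_re_pos (by nlinarith [mul_pos h hS]), ?_, ?_⟩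
  · have e : 1 / (ω * sqBr a ω⁻¹) = ω⁻¹ / sqBr a ω⁻¹ := by
      rw [one_div, mul_inv, div_eq_mul_inv]
    rw [e]
    exact div_re_pos (by nlinarith [mul_pos hinv hT])
  · rintro (h' | h')
    · exact absurd h' h.ne'
    · rw [div_im, h', i2 h']; simp

lemma saddleTerms_I_mul {a t : ℝ} (hs : 0 < Real.sqrt (2 * cOf a))
    (h1 : Real.sqrt (2 * cOf a) < t) (h2 : t < 1 / Real.sqrt (2 * cOf a)) :
    SaddleTerms a (I * t) := by
  have ht : 0 < t := hs.trans h1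
  have hst : Real.sqrt (2 * cOf a) < 1 / t := by
    rw [lt_div_iff₀ ht]; rw [lt_div_iff₀ hs] at h2; linarith
  have h0 : I * (t : ℂ) ≠ 0 := mul_ne_zero I_ne_zero (ofReal_ne_zero.2 ht.ne')
  have hinv : (I * (t : ℂ))⁻¹ = I * ((-(1 / t) : ℝ) : ℂ) := by
    rw [mul_inv, inv_I]; push_cast; ring
  have aux : ∀ u : ℝ, u + Real.sqrt (2 * cOf a) ≠ 0 → u - Real.sqrt (2 * cOf a) ≠ 0 →
      sqBr a (I * u) ^ 2 = (I * u) ^ 2 + ((Real.sqrt (2 * cOf a) ^ 2 : ℝ) : ℂ) := by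
    intro u p m
    apply sqBr_sq
    · rw [← mul_add, ← ofReal_add]
      exact mul_ne_zero I_ne_zero (ofReal_ne_zero.2 p)
    · rw [← mul_sub, ← ofReal_sub]
      exact mul_ne_zero I_ne_zero (ofReal_ne_zero.2 m)
  obtain ⟨s1, s2⟩ := sqBr_I_mul_of_lt h1
  obtain ⟨t1, t2⟩ := sqBr_I_mul_of_lt_neg (a := a) (t := -(1 / t)) (by linarith)
  refine ⟨h0, aux t (by linarith) (by linarith), ?_, ?_, ?_, ?_⟩
  · rw [hinv]; exact aux _ (by linarith) (by linarith)
  · apply div_re_pos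
    simp only [mul_re, mul_im, I_re, I_im, ofReal_re, ofReal_im]
    nlinarith [mul_pos ht s2]
  · rw [hinv]
    apply div_re_pos
    simp only [mul_re, mul_im, I_re, I_im, ofReal_re, ofReal_im, one_re, one_im]
    nlinarith [mul_neg_of_pos_of_neg ht t2]
  · intro _
    rw [div_im, s1]; simp

lemma saddleTerms_of_notMem_cuts {a : ℝ} (hs : 0 < Real.sqrt (2 * cOf a)) {ω : ℂ}
    (hc : ω ∉ cuts a) (hre : 0 ≤ ω.re) (him : 0 ≤ ω.im) : SaddleTerms a ω := by
  rcases hre.lt_or_eq with h | h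
  · exact saddleTerms_of_re_pos a h
  · have e : ω = I * (ω.im : ℂ) := by
      apply Complex.ext <;> simp [← h]
    have hc' : ¬ (ω.im ≤ -(1 / Real.sqrt (2 * cOf a)) ∨
      (-Real.sqrt (2 * cOf a) ≤ ω.im ∧ ω.im ≤ Real.sqrt (2 * cOf a)) ∨
      1 / Real.sqrt (2 * cOf a) ≤ ω.im) := fun h' => hc ⟨ω.im, e, h'⟩
    push Not at hc'
    rw [e]
    exact saddleTerms_I_mul hs (hc'.2.1 (by linarith)) hc'.2.2

lemma SaddleTerms.left_sq {a : ℝ} {ω : ℂ} (h : SaddleTerms a ω) :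
    (ω / sqBr a ω) ^ 2 = ω ^ 2 / (ω ^ 2 + ((Real.sqrt (2 * cOf a) ^ 2 : ℝ) : ℂ)) := by
  rw [div_pow, h.sq_left]

lemma SaddleTerms.right_sq {a : ℝ} {ω : ℂ} (h : SaddleTerms a ω) :
    (1 / (ω * sqBr a ω⁻¹)) ^ 2 = 1 / (1 + ((Real.sqrt (2 * cOf a) ^ 2 : ℝ) : ℂ) * ω ^ 2) := by
  rw [div_pow, mul_pow, h.sq_right, one_pow]
  have := h.ne_zero
  congr 1
  field_simp

lemma SaddleTerms.left_den_ne_zero {a : ℝ} {ω : ℂ} (h : SaddleTerms a ω) :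
    ω ^ 2 + ((Real.sqrt (2 * cOf a) ^ 2 : ℝ) : ℂ) ≠ 0 := by
  rw [← h.sq_left]; exact pow_ne_zero _ (sqBr_ne_zero _ _)

lemma SaddleTerms.right_den_ne_zero {a : ℝ} {ω : ℂ} (h : SaddleTerms a ω) :
    1 + ((Real.sqrt (2 * cOf a) ^ 2 : ℝ) : ℂ) * ω ^ 2 ≠ 0 := by
  have h0 := h.ne_zero
  have : 1 + ((Real.sqrt (2 * cOf a) ^ 2 : ℝ) : ℂ) * ω ^ 2 = ω ^ 2 * sqBr a ω⁻¹ ^ 2 := by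
    rw [h.sq_right]; field_simp
  rw [this]
  exact mul_ne_zero (pow_ne_zero _ h0) (pow_ne_zero _ (sqBr_ne_zero _ _))

lemma SaddleTerms.add_sq {a : ℝ} {ω : ℂ} (h : SaddleTerms a ω) :
    (ω / sqBr a ω + 1 / (ω * sqBr a ω⁻¹)) ^ 2
      = 1 + 2 * (ω / sqBr a ω * (1 / (ω * sqBr a ω⁻¹)))
        + (1 - ((Real.sqrt (2 * cOf a) ^ 2 : ℝ) : ℂ) ^ 2)
          * (ω / sqBr a ω * (1 / (ω * sqBr a ω⁻¹))) ^ 2 := by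
  have key : (ω / sqBr a ω) ^ 2 + (1 / (ω * sqBr a ω⁻¹)) ^ 2
      - (1 - ((Real.sqrt (2 * cOf a) ^ 2 : ℝ) : ℂ) ^ 2)
        * ((ω / sqBr a ω) ^ 2 * (1 / (ω * sqBr a ω⁻¹)) ^ 2) = 1 := by
    rw [h.left_sq, h.right_sq]
    have d1 := h.left_den_ne_zero
    have d2 := h.right_den_ne_zero
    generalize ((Real.sqrt (2 * cOf a) ^ 2 : ℝ) : ℂ) = q at *
    rw [div_add_div _ _ d1 d2, div_mul_div_comm, ← mul_div_assoc, ← sub_div,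
      div_eq_one_iff_eq (mul_ne_zero d1 d2)]
    ring
  linear_combination key

/-- In the regime of the theorem, two numbers with positive real parts related as the saddle
point terms are non-real and complex conjugate. -/
lemma conj_of_add_eq {A B : ℂ} {q r : ℝ} (hq0 : 0 < q) (hq1 : q < 1)
    (hl : 4 < r ^ 2 * (1 + q)) (hr : r ^ 2 * (1 - q) < 4) (hA : 0 < A.re) (hB : 0 < B.re)
    (hAB : A + B = r) (h : (A + B) ^ 2 = 1 + 2 * (A * B) + (1 - (q : ℂ) ^ 2) * (A * B) ^ 2) :
    A.im ≠ 0 ∧ B = conj A := by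
  rw [hAB] at h
  have e1 : A.re + B.re = r := by simpa using congrArg re hAB
  have e2 : A.im + B.im = 0 := by simpa using congrArg im hAB
  have e2' : B.im = -A.im := by linarith
  have h1 := congrArg re h
  have h2 := congrArg im h
  simp [pow_two] at h1 h2
  rw [e2'] at h1 h2
  set x := A.re
  set u := B.re
  set y := A.im
  have hk : 0 < 1 - q * q := by nlinarith
  have hxu : 0 < x * u := mul_pos hA hB
  have hp : 0 < x * u + y * y := by nlinarith [mul_self_nonneg y]
  have hm : y * (u - x) = 0 := by
    have : (y * (u - x)) * (1 + (1 - q * q) * (x * u + y * y)) = 0 := by linarith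
    exact (mul_eq_zero.1 this).resolve_right (by positivity)
  have hy : y ≠ 0 := by
    intro hy
    rw [hy] at h1
    set p := x * u with hpdef
    have hr2 : r * r = 1 + 2 * p + (1 - q * q) * (p * p) := by linarith
    have hd : 0 ≤ ((1 - q) * p - 1) * ((1 + q) * p - 1) := by
      have : r * r - 4 * p = (x - u) ^ 2 := by rw [← e1]; ring
      nlinarith [sq_nonneg (x - u)]
    rcases le_total 1 ((1 - q) * p) with c | c
    · nlinarith [mul_nonneg (sub_nonneg.2 c) (by positivity : 0 ≤ (1 + q) * p)]
    · have c' : (1 + q) * p ≤ 1 := by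
        by_contra! c'
        have : (1 - q) * p < 1 := by
          nlinarith
        nlinarith [mul_pos (sub_pos.2 this) (sub_pos.2 c')]
      nlinarith [mul_nonneg (sub_nonneg.2 c') (mul_nonneg (sub_nonneg.2 hq1.le) hxu.le)]
  refine ⟨hy, ?_⟩
  have : u = x := by linarith [(mul_eq_zero.1 hm).resolve_left hy]
  apply Complex.ext
  · simpa using this
  · simpa using e2'

lemma normSq_sq_add (ω : ℂ) (q : ℝ) (h : normSq ω = 1) :
    normSq (ω ^ 2 + (q : ℂ)) = (1 - q) ^ 2 + 4 * q * ω.re ^ 2 := by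
  rw [normSq_apply] at *
  simp [pow_two]
  linear_combination (ω.re * ω.re + ω.im * ω.im + 1 - 2 * q) * h

lemma SaddleTerms.normSq_left {a : ℝ} {ω : ℂ} (h : SaddleTerms a ω) (h1 : normSq ω = 1) :
    normSq (ω / sqBr a ω) ^ 2 *
      ((1 - Real.sqrt (2 * cOf a) ^ 2) ^ 2 + 4 * Real.sqrt (2 * cOf a) ^ 2 * ω.re ^ 2) = 1 := by
  rw [← normSq_sq_add ω _ h1, ← map_pow, h.left_sq, ← map_mul,
    div_mul_cancel₀ _ h.left_den_ne_zero, map_pow, h1, one_pow]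

/-- Real algebraic description of the saddle point. -/
lemma saddle_conditions {a r : ℝ} {ω : ℂ} (hs0 : 0 < Real.sqrt (2 * cOf a))
    (hq1 : Real.sqrt (2 * cOf a) ^ 2 < 1)
    (hl : 4 < r ^ 2 * (1 + Real.sqrt (2 * cOf a) ^ 2))
    (hr : r ^ 2 * (1 - Real.sqrt (2 * cOf a) ^ 2) < 4)
    (hc : ω ∉ cuts a) (hre : 0 ≤ ω.re) (him : 0 ≤ ω.im)
    (h : ω / sqBr a ω + 1 / (ω * sqBr a ω⁻¹) = r) :
    0 < ω.re ∧ 0 < ω.im ∧ normSq ω = 1 ∧ ∃ P : ℝ, 0 < P ∧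
      r ^ 2 = 1 + 2 * P + (1 - (Real.sqrt (2 * cOf a) ^ 2) ^ 2) * P ^ 2 ∧
      P ^ 2 * ((1 - Real.sqrt (2 * cOf a) ^ 2) ^ 2
        + 4 * Real.sqrt (2 * cOf a) ^ 2 * ω.re ^ 2) = 1 := by
  have T := saddleTerms_of_notMem_cuts hs0 hc hre him
  obtain ⟨hy, hconj⟩ := conj_of_add_eq (pow_pos hs0 2) hq1 hl hr T.re_left T.re_right h T.add_sq
  have p1 : 0 < ω.re := hre.lt_of_ne fun h' => hy (T.im_left (Or.inl h'.symm))
  have p2 : 0 < ω.im := him.lt_of_ne fun h' => hy (T.im_left (Or.inr h'.symm))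
  have hn : normSq ω = 1 := by
    have e := T.right_sq
    rw [hconj, ← map_pow, T.left_sq, map_div₀, map_add, map_pow, conj_ofReal,
      div_eq_div_iff ?_ T.right_den_ne_zero] at e
    · have hq : ((Real.sqrt (2 * cOf a) ^ 2 : ℝ) : ℂ) ≠ 0 :=
        ofReal_ne_zero.2 (pow_pos hs0 2).ne'
      have e' : ((Real.sqrt (2 * cOf a) ^ 2 : ℝ) : ℂ) * (ω * conj ω) ^ 2
          = ((Real.sqrt (2 * cOf a) ^ 2 : ℝ) : ℂ) * 1 := by linear_combination e
      have e'' := mul_left_cancel₀ hq e'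
      rw [mul_conj] at e''
      have : normSq ω ^ 2 = 1 := by exact_mod_cast e''
      exact (pow_eq_one_iff_of_nonneg (normSq_nonneg _) two_ne_zero).1 this
    · have := (map_ne_zero (starRingEnd ℂ)).2 T.left_den_ne_zero
      rwa [map_add, map_pow, conj_ofReal] at this
  refine ⟨p1, p2, hn, normSq (ω / sqBr a ω), ?_, ?_, T.normSq_left hn⟩
  · exact normSq_pos.2 (div_ne_zero T.ne_zero (sqBr_ne_zero _ _))
  · have e := T.add_sq
    rw [h, hconj, mul_conj] at e
    exact_mod_cast e

lemma notMem_cuts_of_re_pos (a : ℝ) {ω : ℂ} (h : 0 < ω.re) : ω ∉ cuts a := by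
  rintro ⟨t, rfl, -⟩
  simp at h

lemma inv_eq_conj_of_normSq {ω : ℂ} (h : normSq ω = 1) : ω⁻¹ = conj ω := by
  rw [inv_def, h]; simp

lemma add_eq_of_conditions {a r P : ℝ} {ω : ℂ} (hr0 : 0 < r) (hre : 0 < ω.re)
    (hn : normSq ω = 1) (hP : 0 < P)
    (h1 : r ^ 2 = 1 + 2 * P + (1 - (Real.sqrt (2 * cOf a) ^ 2) ^ 2) * P ^ 2)
    (h2 : P ^ 2 * ((1 - Real.sqrt (2 * cOf a) ^ 2) ^ 2
        + 4 * Real.sqrt (2 * cOf a) ^ 2 * ω.re ^ 2) = 1) :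
    ω / sqBr a ω + 1 / (ω * sqBr a ω⁻¹) = r := by
  have T := saddleTerms_of_re_pos a hre
  have hB : 1 / (ω * sqBr a ω⁻¹) = conj (ω / sqBr a ω) := by
    rw [one_div, mul_inv, inv_eq_conj_of_normSq hn, sqBr_conj a hre, map_div₀, div_eq_mul_inv]
  have hPn : normSq (ω / sqBr a ω) = P := by
    have e := T.normSq_left hn
    have hne := right_ne_zero_of_mul_eq_one h2
    have := mul_right_cancel₀ hne (e.trans h2.symm)
    exact (pow_left_inj₀ (normSq_nonneg _) hP.le two_ne_zero).1 this
  have e := T.add_sq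
  have pos := T.re_left
  rw [hB, mul_conj, hPn, add_conj] at e
  rw [hB, add_conj]
  have e' : (2 * (ω / sqBr a ω).re) ^ 2 = r ^ 2 := by
    rw [h1]; exact_mod_cast e
  exact congrArg _ ((pow_left_inj₀ (by positivity) hr0.le two_ne_zero).1 e')

lemma exists_root {q r : ℝ} (hq0 : 0 < q) (hq1 : q < 1)
    (hl : 4 < r ^ 2 * (1 + q)) (hr : r ^ 2 * (1 - q) < 4) :
    ∃ P X : ℝ, 0 < P ∧ 0 < X ∧ X < 1 ∧ r ^ 2 = 1 + 2 * P + (1 - q ^ 2) * P ^ 2 ∧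
      P ^ 2 * ((1 - q) ^ 2 + 4 * q * X ^ 2) = 1 := by
  have hk : 0 < 1 - q ^ 2 := by nlinarith
  have hr1 : 1 < r ^ 2 := by nlinarith
  obtain ⟨D, hD0, hD⟩ : ∃ D : ℝ, 0 ≤ D ∧ D ^ 2 = 1 + (1 - q ^ 2) * (r ^ 2 - 1) :=
    ⟨_, Real.sqrt_nonneg _, Real.sq_sqrt (by nlinarith)⟩
  have hD1 : 1 < D := by nlinarith [mul_pos hk (sub_pos.2 hr1)]
  set P := (D - 1) / (1 - q ^ 2) with hPdef
  have hP : 0 < P := div_pos (by linarith) hk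
  have hDP : D = 1 + (1 - q ^ 2) * P := by rw [hPdef]; field_simp; ring
  have hrP : r ^ 2 = 1 + 2 * P + (1 - q ^ 2) * P ^ 2 := by
    have : (1 - q ^ 2) * r ^ 2 = (1 - q ^ 2) * (1 + 2 * P + (1 - q ^ 2) * P ^ 2) := by
      rw [hDP] at hD; linarith
    exact mul_left_cancel₀ hk.ne' this
  have b1 : 1 < P * (1 + q) := by
    by_contra! c
    nlinarith [mul_nonneg (sub_nonneg.2 c) (mul_nonneg (sub_nonneg.2 hq1.le) hP.le)]
  have b2 : P * (1 - q) < 1 := by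
    by_contra! c
    nlinarith [mul_nonneg (sub_nonneg.2 c) (by positivity : 0 ≤ (1 + q) * P)]
  have hm : 0 < P * (1 - q) := mul_pos hP (by linarith)
  set Z := (1 - (P * (1 - q)) ^ 2) / (4 * q * P ^ 2) with hZ
  have hZ0 : 0 < Z := div_pos (by nlinarith) (by positivity)
  have hZ1 : Z < 1 := by
    rw [hZ, div_lt_one (by positivity)]
    nlinarith
  refine ⟨P, Real.sqrt Z, hP, Real.sqrt_pos.2 hZ0, ?_, hrP, ?_⟩
  · rw [Real.sqrt_lt' one_pos]; simpa using hZ1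
  · rw [Real.sq_sqrt hZ0.le, hZ]; field_simp; ring

lemma root_unique {q r P P' X X' : ℝ} (hq0 : 0 < q) (hq1 : q < 1) (hP : 0 < P) (hP' : 0 < P')
    (hX : 0 < X) (hX' : 0 < X')
    (h1 : r ^ 2 = 1 + 2 * P + (1 - q ^ 2) * P ^ 2)
    (h1' : r ^ 2 = 1 + 2 * P' + (1 - q ^ 2) * P' ^ 2)
    (h2 : P ^ 2 * ((1 - q) ^ 2 + 4 * q * X ^ 2) = 1)
    (h2' : P' ^ 2 * ((1 - q) ^ 2 + 4 * q * X' ^ 2) = 1) : X = X' := by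
  have hk : 0 < 1 - q ^ 2 := by nlinarith
  have e : (P - P') * (2 + (1 - q ^ 2) * (P + P')) = 0 := by linarith
  have hPP : P = P' := sub_eq_zero.1 ((mul_eq_zero.1 e).resolve_right (by positivity))
  subst hPP
  have e2 := mul_left_cancel₀ (pow_pos hP 2).ne' (h2.trans h2'.symm)
  have e3 : X ^ 2 = X' ^ 2 := by
    apply mul_left_cancel₀ (by positivity : 4 * q ≠ 0)
    linarith
  exact (pow_left_inj₀ hX.le hX'.le two_ne_zero).1 e3

lemma gxi_re_eq_zero (a ξ : ℝ) {ω : ℂ} (hre : 0 < ω.re) (hn : normSq ω = 1) :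
    (gxi a ξ ω).re = 0 := by
  have hG : Gbr a ω⁻¹ = conj (Gbr a ω) := by
    rw [inv_eq_conj_of_normSq hn, Gbr, Gbr, sqBr_conj a hre, map_div₀, map_sub, conj_ofReal]
  have h1 : ‖ω‖ = 1 := by
    have := normSq_eq_norm_sq ω
    rw [hn] at this
    exact (pow_eq_one_iff_of_nonneg (norm_nonneg _) two_ne_zero).1 this.symm
  rw [gxi, add_re, sub_re, re_ofReal_mul, re_ofReal_mul, Lbr_re, Lbr_re, L3_re, hG, norm_conj, h1]
  simp

lemma exists_eq_exp {ω : ℂ} (hre : 0 < ω.re) (him : 0 < ω.im) (hn : normSq ω = 1) :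
    ∃ θ : ℝ, 0 < θ ∧ θ < Real.pi / 2 ∧ ω = exp (I * (θ : ℂ)) := by
  have h1 : ‖ω‖ = 1 := by
    have := normSq_eq_norm_sq ω
    rw [hn] at this
    exact (pow_eq_one_iff_of_nonneg (norm_nonneg _) two_ne_zero).1 this.symm
  refine ⟨arg ω, ?_, ?_, ?_⟩
  · refine (arg_nonneg_iff.2 him.le).lt_of_ne fun h => him.ne' (arg_eq_zero_iff.1 h.symm).2
  · exact (abs_lt.1 (abs_arg_lt_pi_div_two_iff.2 (Or.inl hre))).2
  · have := norm_mul_exp_arg_mul_I ω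
    rw [h1, ofReal_one, one_mul, mul_comm] at this
    exact this.symm

lemma saddleEq_iff {a ξ : ℝ} (hξ : ξ ≠ 0) (ω : ℂ) :
    saddleEq a ξ ξ ω ↔ ω / sqBr a ω + 1 / (ω * sqBr a ω⁻¹) = ((-1 / ξ : ℝ) : ℂ) := by
  have h : (ξ : ℂ) ≠ 0 := ofReal_ne_zero.2 hξ
  have e : 1 + (ξ : ℂ) * ω / sqBr a ω + (ξ : ℂ) / (ω * sqBr a ω⁻¹)
      = 1 + ξ * (ω / sqBr a ω + 1 / (ω * sqBr a ω⁻¹)) := by ring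
  rw [saddleEq, e]
  push_cast
  rw [eq_div_iff h]
  constructor <;> intro h' <;> linear_combination h'

lemma cOf_pos {a : ℝ} (ha : 0 < a) : 0 < cOf a := by unfold cOf; positivity

lemma two_mul_cOf_lt_one {a : ℝ} (ha : a < 1) : 2 * cOf a < 1 := by
  unfold cOf
  rw [← mul_div_assoc, div_lt_one (by positivity)]
  nlinarith [mul_pos (sub_pos.2 ha) (sub_pos.2 ha)]

/-- Let `-(1/2)√(1+2c) < ξ < -(1/2)√(1-2c)`. Then there is exactly one
`ω ∈ ℂ ∖ 𝒞` with `Re ω ≥ 0` and `Im ω ≥ 0` satisfying the saddle point equation with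
`ξ₁ = ξ₂ = ξ`; this solution has the form `ω = e^{iθ_c}` for some `θ_c ∈ (0, π/2)`, and
`Re g_ξ(ω) = 0`. -/
theorem statement10 (a : ℝ) (ha0 : 0 < a) (ha1 : a < 1) (ξ : ℝ)
    (hξl : -(1 / 2) * Real.sqrt (1 + 2 * cOf a) < ξ)
    (hξr : ξ < -(1 / 2) * Real.sqrt (1 - 2 * cOf a)) :
    (∃! ω : ℂ, ω ∉ cuts a ∧ 0 ≤ ω.re ∧ 0 ≤ ω.im ∧ saddleEq a ξ ξ ω) ∧
    (∀ ω : ℂ, ω ∉ cuts a → 0 ≤ ω.re → 0 ≤ ω.im → saddleEq a ξ ξ ω →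
      (∃ θc : ℝ, 0 < θc ∧ θc < Real.pi / 2 ∧ ω = Complex.exp (Complex.I * (θc : ℂ))) ∧
      (gxi a ξ ω).re = 0) := by
  have hc0 := cOf_pos ha0
  have hc1 := two_mul_cOf_lt_one ha1
  have hs0 : 0 < Real.sqrt (2 * cOf a) := Real.sqrt_pos.2 (by linarith)
  have hs2 : Real.sqrt (2 * cOf a) ^ 2 = 2 * cOf a := Real.sq_sqrt (by linarith)
  have hq1 : Real.sqrt (2 * cOf a) ^ 2 < 1 := hs2.trans_lt hc1
  have m0 := Real.sqrt_nonneg (1 - 2 * cOf a)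
  have m2 := Real.sq_sqrt (by linarith : 0 ≤ 1 - 2 * cOf a)
  have p0 := Real.sqrt_nonneg (1 + 2 * cOf a)
  have p2 := Real.sq_sqrt (by linarith : 0 ≤ 1 + 2 * cOf a)
  have hξ : ξ < 0 := by linarith
  have hr0 : 0 < -1 / ξ := div_pos_of_neg_of_neg (by norm_num) hξ
  have hξ2 : 0 < ξ ^ 2 := sq_pos_of_neg hξ
  have hl : 4 < (-1 / ξ) ^ 2 * (1 + Real.sqrt (2 * cOf a) ^ 2) := by
    rw [hs2, div_pow, div_mul_eq_mul_div, lt_div_iff₀ hξ2]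
    nlinarith
  have hr : (-1 / ξ) ^ 2 * (1 - Real.sqrt (2 * cOf a) ^ 2) < 4 := by
    rw [hs2, div_pow, div_mul_eq_mul_div, div_lt_iff₀ hξ2]
    nlinarith
  have key : ∀ ω : ℂ, ω ∉ cuts a → 0 ≤ ω.re → 0 ≤ ω.im → saddleEq a ξ ξ ω → _ :=
    fun ω h1 h2 h3 h4 =>
      saddle_conditions hs0 hq1 hl hr h1 h2 h3 ((saddleEq_iff hξ.ne ω).1 h4)
  refine ⟨?_, fun ω h1 h2 h3 h4 => ?_⟩
  · obtain ⟨P, X, hP, hX, hX1, e1, e2⟩ := exists_root (pow_pos hs0 2) hq1 hl hr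
    have hY : 0 < 1 - X ^ 2 := by nlinarith
    have hn : normSq (⟨X, Real.sqrt (1 - X ^ 2)⟩ : ℂ) = 1 := by
      rw [normSq_mk, Real.mul_self_sqrt hY.le]; ring
    refine ⟨⟨X, Real.sqrt (1 - X ^ 2)⟩,
      ⟨notMem_cuts_of_re_pos a hX, hX.le, Real.sqrt_nonneg _,
        (saddleEq_iff hξ.ne _).2 (add_eq_of_conditions hr0 hX hn hP e1 e2)⟩, ?_⟩
    rintro ω ⟨h1, h2, h3, h4⟩
    obtain ⟨k1, k2, k3, P', k4, k5, k6⟩ := key ω h1 h2 h3 h4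
    have hXe : ω.re = X := root_unique (pow_pos hs0 2) hq1 k4 hP k1 hX k5 e1 k6 e2
    apply Complex.ext
    · exact hXe
    · rw [normSq_apply, hXe] at k3
      rw [show 1 - X ^ 2 = ω.im ^ 2 by linarith, Real.sqrt_sq h3]
  · obtain ⟨k1, k2, k3, -⟩ := key ω h1 h2 h3 h4
    exact ⟨exists_eq_exp k1 k2 k3, gxi_re_eq_zero a ξ k1 k3⟩
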